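/- Let G be a non-elementary word-hyperbolic group with a finite generating set X. Then G has exponential growth: there exists λ > 1 such that 𝔅(n) ≥ λⁿ for all sufficiently large n; equivalently, the growth rate lim_{n→∞} 𝔅(n)^{1/n} is strictly greater than 1. -/

import Mathlib

/-!
Coornaert's theorem: a non-elementary word-hyperbolic group has purely
exponential growth of balls.
-/

/-- The word length of `g` with respect to a generating set `X`: the least `n` such that
`g` is a product of `n` elements of `X ∪ X⁻¹`. -/
noncomputable def wordLength {G : Type*} [Group G] (X : Set G) (g : G) : ℕ :=
  sInf {n | ∃ w : List G, w.length = n ∧ (∀ x ∈ w, x ∈ X ∨ x⁻¹ ∈ X) ∧ w.prod = g}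

/-- The word metric `d(g,h) = |g⁻¹h|_X`. -/
noncomputable def wordDist {G : Type*} [Group G] (X : Set G) (g h : G) : ℕ :=
  wordLength X (g⁻¹ * h)

/-- `𝔖(n)`, the cardinality of the sphere of radius `n`. -/
noncomputable def sphereCard {G : Type*} [Group G] (X : Set G) (n : ℕ) : ℕ :=
  {g : G | wordLength X g = n}.ncard

/-- `𝔅(n)`, the cardinality of the ball of radius `n`. -/
noncomputable def ballCard {G : Type*} [Group G] (X : Set G) (n : ℕ) : ℕ :=
  {g : G | wordLength X g ≤ n}.ncard

/-- A (discrete) geodesic in the Cayley graph `Γ(G,X)` from `a` to `b`: the sequence of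
vertices visited by a geodesic path, parametrised by arc length. -/
def IsGeodesic {G : Type*} [Group G] (X : Set G) (a b : G) (γ : ℕ → G) : Prop :=
  γ 0 = a ∧ γ (wordDist X a b) = b ∧
    ∀ i j, i ≤ wordDist X a b → j ≤ wordDist X a b →
      wordDist X (γ i) (γ j) = Nat.dist i j

/-- Triangles in the Cayley graph `Γ(G,X)` are `δ`-thin (`δ` a positive integer): every
vertex on one side of a geodesic triangle is at distance at most `δ` from the union of the
other two sides. -/
def TrianglesThin {G : Type*} [Group G] (X : Set G) (δ : ℕ) : Prop :=
  ∀ (a b c : G) (γ₁ γ₂ γ₃ : ℕ → G),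
    IsGeodesic X a b γ₁ → IsGeodesic X b c γ₂ → IsGeodesic X a c γ₃ →
    ∀ i ≤ wordDist X a c, ∃ j,
      (j ≤ wordDist X a b ∧ wordDist X (γ₃ i) (γ₁ j) ≤ δ) ∨
      (j ≤ wordDist X b c ∧ wordDist X (γ₃ i) (γ₂ j) ≤ δ)

/-- A group is virtually cyclic if it has a cyclic subgroup of finite index. -/
def VirtuallyCyclic (G : Type*) [Group G] : Prop :=
  ∃ H : Subgroup G, IsCyclic H ∧ H.FiniteIndex

section WordMetric

variable {G : Type*} [Group G] {X : Set G}

theorem wordLength_prod_le {w : List G} (hw : ∀ x ∈ w, x ∈ X ∨ x⁻¹ ∈ X) :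
    wordLength X w.prod ≤ w.length :=
  Nat.sInf_le ⟨w, rfl, hw, rfl⟩

theorem exists_word_length_eq (hX : Subgroup.closure X = ⊤) (g : G) :
    ∃ w : List G, w.length = wordLength X g ∧ (∀ x ∈ w, x ∈ X ∨ x⁻¹ ∈ X) ∧ w.prod = g := by
  have hmem : g ∈ Submonoid.closure (X ∪ X⁻¹) := by
    rw [← Subgroup.closure_toSubmonoid, hX]
    trivial
  obtain ⟨l, hl, hg⟩ := Submonoid.exists_list_of_mem_closure hmem
  exact Nat.sInf_mem
    (s := {n | ∃ w : List G, w.length = n ∧ (∀ x ∈ w, x ∈ X ∨ x⁻¹ ∈ X) ∧ w.prod = g})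
    ⟨l.length, l, rfl, hl, hg⟩

theorem wordLength_one : wordLength X (1 : G) = 0 := by
  simpa using wordLength_prod_le (X := X) (w := []) (by simp)

theorem wordLength_mul_le (hX : Subgroup.closure X = ⊤) (g h : G) :
    wordLength X (g * h) ≤ wordLength X g + wordLength X h := by
  obtain ⟨v, hv, hv', rfl⟩ := exists_word_length_eq hX g
  obtain ⟨w, hw, hw', rfl⟩ := exists_word_length_eq hX h
  rw [← hv, ← hw, ← List.prod_append, ← List.length_append]
  refine wordLength_prod_le fun x hx => ?_
  rcases List.mem_append.1 hx with hx | hx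
  exacts [hv' x hx, hw' x hx]

theorem wordLength_inv_le (hX : Subgroup.closure X = ⊤) (g : G) :
    wordLength X g⁻¹ ≤ wordLength X g := by
  obtain ⟨v, hv, hv', rfl⟩ := exists_word_length_eq hX g
  rw [← hv, List.prod_inv_reverse]
  refine (wordLength_prod_le fun x hx => ?_).trans (by simp)
  simp only [List.mem_reverse, List.mem_map] at hx
  obtain ⟨y, hy, rfl⟩ := hx
  simpa [or_comm] using hv' y hy

theorem wordLength_inv (hX : Subgroup.closure X = ⊤) (g : G) :
    wordLength X g⁻¹ = wordLength X g :=
  (wordLength_inv_le hX g).antisymm (by simpa using wordLength_inv_le hX g⁻¹)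

theorem wordDist_comm (hX : Subgroup.closure X = ⊤) (g h : G) :
    wordDist X g h = wordDist X h g := by
  rw [wordDist, ← wordLength_inv hX, wordDist]
  simp

theorem wordDist_triangle (hX : Subgroup.closure X = ⊤) (g h k : G) :
    wordDist X g k ≤ wordDist X g h + wordDist X h k := by
  simpa [wordDist, mul_assoc] using wordLength_mul_le hX (g⁻¹ * h) (h⁻¹ * k)

theorem exists_isGeodesic (hX : Subgroup.closure X = ⊤) (a b : G) :
    ∃ γ : ℕ → G, IsGeodesic X a b γ := by
  obtain ⟨w, hw, hw', hb⟩ := exists_word_length_eq hX (a⁻¹ * b)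
  set n := wordDist X a b
  have hwn : w.length = n := hw
  have le_sub : ∀ i j, i ≤ j →
      wordDist X (a * (w.take i).prod) (a * (w.take j).prod) ≤ j - i := by
    intro i j hij
    have hsplit : (w.take j).prod = (w.take i).prod * ((w.take j).drop i).prod := by
      rw [← List.prod_append]
      congr 1
      conv_lhs => rw [← List.take_append_drop i (w.take j)]
      rw [List.take_take, min_eq_left hij]
    rw [wordDist, hsplit]
    have : (a * (w.take i).prod)⁻¹ * (a * ((w.take i).prod * ((w.take j).drop i).prod)) =
        ((w.take j).drop i).prod := by group
    rw [this]
    refine (wordLength_prod_le fun x hx => hw' x ?_).trans ?_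
    · exact List.mem_of_mem_take (List.mem_of_mem_drop hx)
    · simp only [List.length_drop, List.length_take]
      omega
  have hzero : a * (w.take 0).prod = a := by simp
  have hend : a * (w.take n).prod = b := by
    rw [← hwn, List.take_length, hb]
    group
  have eq_sub : ∀ i j, i ≤ j → j ≤ n →
      wordDist X (a * (w.take i).prod) (a * (w.take j).prod) = j - i := by
    intro i j hij hj
    have h₁ := le_sub i j hij
    have h₂ := le_sub 0 i (Nat.zero_le i)
    have h₃ := le_sub j n hj
    rw [hzero] at h₂
    rw [hend] at h₃
    have h₄ := wordDist_triangle hX a (a * (w.take i).prod) b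
    have h₅ := wordDist_triangle hX (a * (w.take i).prod) (a * (w.take j).prod) b
    omega
  refine ⟨fun i => a * (w.take i).prod, hzero, hend, fun i j hi hj => ?_⟩
  rcases le_total i j with h | h
  · rw [Nat.dist_eq_sub_of_le h]
    exact eq_sub i j h hj
  · rw [Nat.dist_comm, Nat.dist_eq_sub_of_le h, wordDist_comm hX]
    exact eq_sub j i h hi

theorem IsGeodesic.wordDist_left {a b : G} {γ : ℕ → G} (h : IsGeodesic X a b γ) {i : ℕ}
    (hi : i ≤ wordDist X a b) : wordDist X a (γ i) = i := by
  have := h.2.2 0 i (Nat.zero_le _) hi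
  rwa [h.1, Nat.dist_eq_sub_of_le (Nat.zero_le _), Nat.sub_zero] at this

theorem IsGeodesic.wordDist_right {a b : G} {γ : ℕ → G} (h : IsGeodesic X a b γ) {i : ℕ}
    (hi : i ≤ wordDist X a b) : wordDist X (γ i) b = wordDist X a b - i := by
  have := h.2.2 i _ hi le_rfl
  rwa [h.2.1, Nat.dist_eq_sub_of_le hi] at this

theorem wordLength_ball_finite {X : Finset G} (hX : Subgroup.closure (X : Set G) = ⊤) (n : ℕ) :
    {g : G | wordLength (X : Set G) g ≤ n}.Finite := by
  have hfin : {x : G | x ∈ (X : Set G) ∨ x⁻¹ ∈ (X : Set G)}.Finite :=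
    X.finite_toSet.union (X.finite_toSet.preimage inv_injective.injOn)
  have : Finite {x : G | x ∈ (X : Set G) ∨ x⁻¹ ∈ (X : Set G)} := hfin
  refine ((List.finite_length_le {x : G | x ∈ (X : Set G) ∨ x⁻¹ ∈ (X : Set G)} n).image
    fun l => (l.map Subtype.val).prod).subset fun g hg => ?_
  obtain ⟨w, hw, hw', rfl⟩ := exists_word_length_eq hX g
  lift w to List {x : G | x ∈ (X : Set G) ∨ x⁻¹ ∈ (X : Set G)} using hw'
  rw [Set.mem_ofPred_eq, ← hw, List.length_map] at hg
  exact ⟨w, hg, rfl⟩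

end WordMetric

/-- Twice the Gromov product, based at `1`, with respect to a length function `ℓ`. -/
def gromovProduct {G : Type*} [Group G] (ℓ : G → ℤ) (x y : G) : ℤ :=
  ℓ x + ℓ y - ℓ (x⁻¹ * y)

/-- A symmetric subadditive length function satisfying Gromov's four-point condition. -/
structure IsHyperbolicLength {G : Type*} [Group G] (ℓ : G → ℤ) (D : ℤ) : Prop where
  map_one : ℓ 1 = 0
  map_inv : ∀ g, ℓ g⁻¹ = ℓ g
  map_mul_le : ∀ g h, ℓ (g * h) ≤ ℓ g + ℓ h
  min_gromovProduct_le : ∀ x y z,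
    min (gromovProduct ℓ x y) (gromovProduct ℓ y z) ≤ gromovProduct ℓ x z + D

section FourPoint

variable {G : Type*} [Group G] {X : Set G}

/-- In a thin triangle, the side opposite to a vertex comes as close to that vertex as the
Gromov product predicts. -/
theorem TrianglesThin.exists_wordDist_le (hX : Subgroup.closure X = ⊤) {δ : ℕ}
    (hδ : TrianglesThin X δ) {x y o : G} {γ : ℕ → G} (hγ : IsGeodesic X x y γ) :
    ∃ i ≤ wordDist X x y,
      2 * wordDist X o (γ i) + wordDist X x y ≤ wordDist X o x + wordDist X o y + 4 * δ + 2 := by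
  obtain ⟨γ₁, h₁⟩ := exists_isGeodesic hX x o
  obtain ⟨γ₂, h₂⟩ := exists_isGeodesic hX o y
  have near : ∀ {a b p : G} {σ : ℕ → G} {j : ℕ}, IsGeodesic X a b σ → j ≤ wordDist X a b →
      wordDist X a p + wordDist X p b ≤ wordDist X a b + 2 * wordDist X p (σ j) := by
    intro a b p σ j hσ hj
    have e₁ := hσ.wordDist_left hj
    have e₂ := hσ.wordDist_right hj
    have t₁ := wordDist_triangle hX a (σ j) p
    have t₂ := wordDist_triangle hX p (σ j) b
    rw [wordDist_comm hX (σ j) p] at t₁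
    omega
  have hcases : ∀ i ≤ wordDist X x y,
      wordDist X x (γ i) + wordDist X (γ i) o ≤ wordDist X x o + 2 * δ ∨
      wordDist X o (γ i) + wordDist X (γ i) y ≤ wordDist X o y + 2 * δ := by
    intro i hi
    obtain ⟨j, ⟨hj, hd⟩ | ⟨hj, hd⟩⟩ := hδ x o y γ₁ γ₂ γ h₁ h₂ hγ i hi
    · left
      have := near (p := γ i) h₁ hj
      omega
    · right
      have := near (p := γ i) h₂ hj
      omega
  -- the last vertex of the side that is close to the side from `x` to `o`
  let P : ℕ → Prop := fun i =>
    wordDist X x (γ i) + wordDist X (γ i) o ≤ wordDist X x o + 2 * δ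
  classical
  have hP0 : P 0 := by
    simp only [P, hγ.1]
    simp [wordDist, wordLength_one]
  set n := wordDist X x y
  set i := Nat.findGreatest P n
  have hin : i ≤ n := Nat.findGreatest_le n
  have hPi : P i := Nat.findGreatest_spec (Nat.zero_le n) hP0
  have l := hγ.wordDist_left hin
  have r := hγ.wordDist_right hin
  have c := wordDist_comm hX (γ i) o
  have c' := wordDist_comm hX x o
  refine ⟨i, hin, ?_⟩
  simp only [P] at hPi
  rcases hin.eq_or_lt with h | h
  · have hend : wordDist X o (γ i) = wordDist X o y := by rw [h, hγ.2.1]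
    omega
  · have hnot : ¬ P (i + 1) := Nat.findGreatest_is_greatest (Nat.lt_succ_self i) h
    have hs := (hcases (i + 1) h).resolve_left hnot
    have step : wordDist X (γ i) (γ (i + 1)) = 1 := by
      rw [hγ.2.2 i (i + 1) hin h, Nat.dist_eq_sub_of_le (Nat.le_succ i)]
      omega
    have r' := hγ.wordDist_right (i := i + 1) h
    have t := wordDist_triangle hX o (γ (i + 1)) (γ i)
    rw [wordDist_comm hX (γ (i + 1))] at t
    omega

theorem TrianglesThin.isHyperbolicLength (hX : Subgroup.closure X = ⊤) {δ : ℕ}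
    (hδ : TrianglesThin X δ) :
    IsHyperbolicLength (fun g => (wordLength X g : ℤ)) (6 * δ + 2) where
  map_one := by simp [wordLength_one]
  map_inv g := by simp [wordLength_inv hX]
  map_mul_le g h := by exact_mod_cast wordLength_mul_le hX g h
  min_gromovProduct_le x y z := by
    obtain ⟨γ₁, h₁⟩ := exists_isGeodesic hX x y
    obtain ⟨γ₂, h₂⟩ := exists_isGeodesic hX y z
    obtain ⟨γ, hγ⟩ := exists_isGeodesic hX x z
    obtain ⟨i, hi, hclose⟩ := hδ.exists_wordDist_le hX (o := 1) hγ
    have len : ∀ g, wordLength X g = wordDist X 1 g := fun g => by simp [wordDist]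
    have far : ∀ {a b : G} {σ : ℕ → G} {j : ℕ}, IsGeodesic X a b σ → j ≤ wordDist X a b →
        wordDist X 1 a + wordDist X 1 b ≤ 2 * wordDist X 1 (σ j) + wordDist X a b := by
      intro a b σ j hσ hj
      have e₁ := hσ.wordDist_left hj
      have e₂ := hσ.wordDist_right hj
      have t₁ := wordDist_triangle hX 1 (σ j) a
      have t₂ := wordDist_triangle hX 1 (σ j) b
      rw [wordDist_comm hX (σ j) a] at t₁
      omega
    have hd : ∀ g h : G, wordLength X (g⁻¹ * h) = wordDist X g h := fun _ _ => rfl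
    simp only [gromovProduct, hd]
    simp only [len]
    obtain ⟨j, ⟨hj, hd⟩ | ⟨hj, hd⟩⟩ := hδ x y z γ₁ γ₂ γ h₁ h₂ hγ i hi
    · have f := far h₁ hj
      have t := wordDist_triangle hX 1 (γ i) (γ₁ j)
      refine (min_le_left _ _).trans ?_
      omega
    · have f := far h₂ hj
      have t := wordDist_triangle hX 1 (γ i) (γ₂ j)
      refine (min_le_right _ _).trans ?_
      omega

end FourPoint

namespace IsHyperbolicLength

variable {G : Type*} [Group G] {ℓ : G → ℤ} {D : ℤ}

theorem nonneg (h : IsHyperbolicLength ℓ D) (g : G) : 0 ≤ ℓ g := by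
  have h₁ := h.map_mul_le g g⁻¹
  have h₂ := h.map_inv g
  rw [mul_inv_cancel, h.map_one] at h₁
  omega

theorem gromovProduct_comm (h : IsHyperbolicLength ℓ D) (x y : G) :
    gromovProduct ℓ x y = gromovProduct ℓ y x := by
  have := h.map_inv (x⁻¹ * y)
  simp only [mul_inv_rev, inv_inv] at this
  simp only [gromovProduct, this]
  ring

theorem gromovProduct_self (h : IsHyperbolicLength ℓ D) (x : G) :
    gromovProduct ℓ x x = 2 * ℓ x := by
  simp [gromovProduct, h.map_one, two_mul]

theorem gromovProduct_one_right (h : IsHyperbolicLength ℓ D) (x : G) :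
    gromovProduct ℓ x 1 = 0 := by
  simp [gromovProduct, h.map_one, h.map_inv]

theorem constant_nonneg (h : IsHyperbolicLength ℓ D) : 0 ≤ D := by
  have := h.min_gromovProduct_le 1 1 1
  rw [min_self] at this
  omega

/-- The length of a product in terms of the Gromov product at the corner. -/
theorem map_mul_eq (h : IsHyperbolicLength ℓ D) (x y : G) :
    ℓ (x * y) = ℓ x + ℓ y - gromovProduct ℓ x⁻¹ y := by
  simp [gromovProduct, h.map_inv]

/-- If `z` starts like the long element `s`, and `t * s` is almost reduced, then `t * z` starts
like `t`. -/
theorem gromovProduct_mul_left (h : IsHyperbolicLength ℓ D) {C : ℤ} {s t z : G}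
    (hs : C + D < ℓ s) (hz : 2 * ℓ s - C - D ≤ gromovProduct ℓ z s)
    (ht : gromovProduct ℓ t⁻¹ s ≤ C) :
    gromovProduct ℓ t⁻¹ z ≤ C + D ∧ 2 * ℓ t - C - D ≤ gromovProduct ℓ (t * z) t := by
  have hmin := h.min_gromovProduct_le t⁻¹ z s
  have hcorner : gromovProduct ℓ t⁻¹ z ≤ C + D := by
    rcases min_le_iff.1 hmin with h' | h' <;> omega
  refine ⟨hcorner, ?_⟩
  have e := h.map_mul_eq t z
  rw [h.gromovProduct_comm, gromovProduct, inv_mul_cancel_left]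
  omega

/-- Powers of an element whose square is almost reduced are almost reduced. -/
theorem pow_spec (h : IsHyperbolicLength ℓ D) {a : G}
    (ha : gromovProduct ℓ a⁻¹ a + 2 * D < ℓ a) (n : ℕ) :
    (n : ℤ) ≤ ℓ (a ^ n) ∧ gromovProduct ℓ a⁻¹ (a ^ n) ≤ gromovProduct ℓ a⁻¹ a + D ∧
      2 * ℓ a - gromovProduct ℓ a⁻¹ a - D ≤ gromovProduct ℓ (a ^ (n + 1)) a := by
  have hD := h.constant_nonneg
  have hn := h.nonneg
  have hc : 0 ≤ gromovProduct ℓ a⁻¹ a := by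
    have := h.map_mul_eq a a
    have := h.map_mul_le a a
    omega
  induction n with
  | zero =>
    have e := h.gromovProduct_one_right a⁻¹
    have e' := h.gromovProduct_self a
    have := hn a
    simp only [pow_zero, e, zero_add, pow_one, e', h.map_one]
    omega
  | succ n ih =>
    obtain ⟨h₁, h₂, h₃⟩ := ih
    have hs := h.gromovProduct_mul_left (C := gromovProduct ℓ a⁻¹ a) (t := a) (by omega) h₃ le_rfl
    rw [← pow_succ'] at hs
    refine ⟨?_, hs⟩
    have e := h.map_mul_eq a (a ^ n)
    rw [← pow_succ'] at e
    push_cast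
    omega

theorem gromovProduct_pow_inv_pow (h : IsHyperbolicLength ℓ D) {a : G}
    (ha : gromovProduct ℓ a⁻¹ a + 2 * D < ℓ a) (m n : ℕ) :
    gromovProduct ℓ (a ^ m)⁻¹ (a ^ n) ≤ gromovProduct ℓ a⁻¹ a + 2 * D := by
  have hD := h.constant_nonneg
  have ha' : gromovProduct ℓ a⁻¹⁻¹ a⁻¹ + 2 * D < ℓ a⁻¹ := by
    rwa [h.map_inv, h.gromovProduct_comm, inv_inv]
  have hc : 0 ≤ gromovProduct ℓ a⁻¹ a := by
    have := h.map_mul_eq a a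
    have := h.map_mul_le a a
    omega
  cases n with
  | zero =>
    have e := h.gromovProduct_one_right (a ^ m)⁻¹
    simp only [pow_zero, e]
    omega
  | succ n =>
    have h₁ := (h.pow_spec ha n).2.2
    have h₂ := (h.pow_spec ha' m).2.1
    rw [inv_inv, inv_pow, h.gromovProduct_comm, h.gromovProduct_comm a] at h₂
    rcases min_le_iff.1 (h.min_gromovProduct_le (a ^ m)⁻¹ (a ^ (n + 1)) a) with h' | h' <;> omega

/-- Points whose nearest point projection to `⟨a⟩` is `1` have bounded Gromov product with the
powers of `a`. -/
theorem exists_gromovProduct_zpow_le (h : IsHyperbolicLength ℓ D) {a : G}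
    (ha : gromovProduct ℓ a⁻¹ a + 2 * D < ℓ a) :
    ∃ C, ∀ g, (∀ n : ℤ, ℓ g ≤ ℓ (a ^ n * g)) → ∀ n : ℤ, gromovProduct ℓ g (a ^ n) ≤ C := by
  have key : ∀ a : G, gromovProduct ℓ a⁻¹ a + 2 * D < ℓ a →
      ∃ C, ∀ g, (∀ n : ℤ, ℓ g ≤ ℓ (a ^ n * g)) → ∀ n : ℕ, gromovProduct ℓ g (a ^ n) ≤ C := by
    intro a ha
    obtain ⟨k, hk⟩ : ∃ k : ℕ, gromovProduct ℓ a⁻¹ a + 3 * D < k :=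
      ⟨(gromovProduct ℓ a⁻¹ a + 3 * D).toNat + 1, by omega⟩
    obtain ⟨M, hM⟩ : BddAbove ((fun n : ℕ => ℓ (a ^ n)) '' Set.Iic k) :=
      ((Set.finite_Iic k).image _).bddAbove
    have hD := h.constant_nonneg
    refine ⟨M + D, fun g hg n => ?_⟩
    have near : ∀ m : ℕ, gromovProduct ℓ g (a ^ m) ≤ ℓ (a ^ m) := by
      intro m
      have := hg (-m)
      rw [zpow_neg, zpow_natCast] at this
      rw [h.gromovProduct_comm, gromovProduct]
      omega
    have hMk : ∀ m ≤ k, ℓ (a ^ m) ≤ M := fun m hm => hM ⟨m, hm, rfl⟩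
    rcases le_total n k with hn | hn
    · have := near n
      have := hMk n hn
      omega
    · obtain ⟨m, rfl⟩ := Nat.exists_eq_add_of_le hn
      have h₁ := h.gromovProduct_pow_inv_pow ha k m
      have h₂ := h.map_mul_eq (a ^ k) (a ^ m)
      have h₃ : gromovProduct ℓ (a ^ (k + m)) (a ^ k) =
          ℓ (a ^ k) + ℓ (a ^ k * a ^ m) - ℓ (a ^ m) := by
        rw [h.gromovProduct_comm, gromovProduct, pow_add, inv_mul_cancel_left]
      have h₄ := (h.pow_spec ha k).1
      have h₅ := near k
      have h₆ := hMk k le_rfl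
      rcases min_le_iff.1 (h.min_gromovProduct_le g (a ^ (k + m)) (a ^ k)) with h' | h' <;> omega
  obtain ⟨C₁, h₁⟩ := key a ha
  obtain ⟨C₂, h₂⟩ := key a⁻¹ (by rwa [h.map_inv, h.gromovProduct_comm, inv_inv])
  refine ⟨max C₁ C₂, fun g hg n => ?_⟩
  obtain ⟨m, rfl | rfl⟩ := n.eq_nat_or_neg
  · rw [zpow_natCast]
    exact (h₁ g hg m).trans (le_max_left _ _)
  · rw [zpow_neg, zpow_natCast, ← inv_pow]
    refine (h₂ g (fun n => ?_) m).trans (le_max_right _ _)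
    simpa [inv_zpow'] using hg (-n)

/-- If the products of `g` with powers of `a` are almost reduced, then `a ^ N * g` and
`a ^ (2 * N) * g` freely generate a subsemigroup. -/
theorem exists_injective_prod (h : IsHyperbolicLength ℓ D) {a g : G} {C : ℤ} {N : ℕ}
    (hN : C + D < ℓ (a ^ N)) (hN' : C + D < ℓ (a ^ (2 * N))) (hg : C + D < ℓ g)
    (hleft : ∀ n : ℤ, gromovProduct ℓ g (a ^ n) ≤ C)
    (hright : ∀ n : ℕ, gromovProduct ℓ g⁻¹ (a ^ n) ≤ C) :
    ∃ u : Bool → G, Function.Injective fun l : List Bool => (l.map u).prod := by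
  let e : Bool → ℕ := fun b => cond b (2 * N) N
  let u : Bool → G := fun b => a ^ e b * g
  have he : ∀ b, C + D < ℓ (a ^ e b) := by rintro (_ | _) <;> assumption
  have hD := h.constant_nonneg
  have hC : 0 ≤ C := by
    simpa [h.gromovProduct_one_right] using hleft 0
  have prepend : ∀ (m : ℕ) (z : G), 2 * ℓ g - C - D ≤ gromovProduct ℓ z g →
      2 * ℓ (a ^ m) - C - D ≤ gromovProduct ℓ (a ^ m * z) (a ^ m) := by
    intro m z hz
    refine (h.gromovProduct_mul_left hg hz ?_).2
    simpa [h.gromovProduct_comm g] using hleft (-m)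
  have start : ∀ l : List Bool, 2 * ℓ g - C - D ≤ gromovProduct ℓ (g * (l.map u).prod) g := by
    intro l
    induction l with
    | nil =>
      simp only [List.map_nil, List.prod_nil, mul_one, h.gromovProduct_self]
      omega
    | cons b l ih =>
      simp only [List.map_cons, List.prod_cons, u, mul_assoc]
      exact (h.gromovProduct_mul_left (he b) (prepend _ _ ih) (hright _)).2
  have diverge : ∀ (m : ℕ), C + D < ℓ (a ^ m) → ∀ l l' : List Bool,
      a ^ m * (g * (l.map u).prod) ≠ g * (l'.map u).prod := by
    intro m hm l l' heq
    have h₁ := prepend m _ (start l)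
    have h₂ := start l'
    rw [heq] at h₁
    have h₃ := hleft m
    rw [zpow_natCast] at h₃
    rw [h.gromovProduct_comm] at h₂
    rcases min_le_iff.1 (h.min_gromovProduct_le g (g * (l'.map u).prod) (a ^ m)) with h' | h' <;>
      omega
  have ne_nil : ∀ (b : Bool) (l : List Bool), u b * (l.map u).prod ≠ 1 := by
    intro b l heq
    have h₁ := prepend (e b) _ (start l)
    rw [← mul_assoc, heq] at h₁
    have : gromovProduct ℓ 1 (a ^ e b) = 0 := by simp [gromovProduct, h.map_one]
    have := he b
    omega
  refine ⟨u, fun l => ?_⟩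
  induction l with
  | nil =>
    rintro (_ | ⟨b, l'⟩) heq
    · rfl
    · exact absurd heq.symm (by simpa using ne_nil b l')
  | cons b l ih =>
    rintro (_ | ⟨b', l'⟩) heq
    · exact absurd heq (by simpa using ne_nil b l)
    · simp only [List.map_cons, List.prod_cons] at heq
      have hb : b = b' := by
        by_contra hb
        have two : a ^ (2 * N) = a ^ N * a ^ N := by rw [two_mul, pow_add]
        cases b <;> cases b' <;> simp only [not_true_eq_false, u, e, cond, two, mul_assoc,
          mul_right_inj] at hb heq
        · exact diverge N hN l' l heq.symm
        · exact diverge N hN l l' heq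
      subst hb
      rw [mul_right_inj] at heq
      rw [ih heq]

/-- A loxodromic element together with points arbitrarily far from its axis gives a free
subsemigroup of rank two. -/
theorem exists_free_subsemigroup (h : IsHyperbolicLength ℓ D) {a : G}
    (ha : gromovProduct ℓ a⁻¹ a + 2 * D < ℓ a)
    (hfar : ∀ R, ∃ g, R ≤ ℓ g ∧ ∀ n : ℤ, ℓ g ≤ ℓ (a ^ n * g)) :
    ∃ u : Bool → G, Function.Injective fun l : List Bool => (l.map u).prod := by
  have hD := h.constant_nonneg
  obtain ⟨C₀, hC₀⟩ := h.exists_gromovProduct_zpow_le ha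
  set C := max C₀ (gromovProduct ℓ a⁻¹ a + 3 * D)
  have hCle : gromovProduct ℓ a⁻¹ a + 3 * D ≤ C := le_max_right _ _
  obtain ⟨g, hgR, hg⟩ := hfar (C + D + 1)
  have hleft : ∀ n : ℤ, gromovProduct ℓ g (a ^ n) ≤ C := fun n =>
    (hC₀ g hg n).trans (le_max_left _ _)
  obtain ⟨N, hN⟩ : ∃ N : ℕ, C + D < N := ⟨(C + D).toNat + 1, by omega⟩
  have h₁ := (h.pow_spec ha N).1
  have h₂ := (h.pow_spec ha (2 * N)).1
  push_cast at h₂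
  by_cases hright : ∀ n : ℕ, gromovProduct ℓ g⁻¹ (a ^ n) ≤ C
  · exact h.exists_injective_prod (N := N) (by omega) (by omega) (by omega) hleft hright
  · push Not at hright
    obtain ⟨m, hm⟩ := hright
    refine h.exists_injective_prod (a := a⁻¹) (g := g) (C := C) (N := N) ?_ ?_ (by omega)
      (fun n => ?_) fun n => ?_
    · rw [inv_pow, h.map_inv]
      omega
    · rw [inv_pow, h.map_inv]
      omega
    · simpa [inv_zpow'] using hleft (-n)
    · have h₃ := h.gromovProduct_pow_inv_pow ha n m
      rw [← inv_pow] at h₃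
      have h₄ := h.min_gromovProduct_le (a⁻¹ ^ n) g⁻¹ (a ^ m)
      rw [h.gromovProduct_comm] at h₄
      rcases min_le_iff.1 h₄ with h' | h' <;> omega

end IsHyperbolicLength

section Growth

variable {G : Type*} [Group G]

/-- A group with a hyperbolic word length and elements of unbounded length contains loxodromic
elements: otherwise long geodesics would be almost periodic. -/
theorem IsHyperbolicLength.exists_loxodromic {X : Set G} (hX : Subgroup.closure X = ⊤) {D : ℤ}
    (h : IsHyperbolicLength (fun g => (wordLength X g : ℤ)) D)
    (hunb : ∀ n : ℕ, ∃ g : G, n ≤ wordLength X g) (K : ℤ) :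
    ∃ a : G, gromovProduct (fun g => (wordLength X g : ℤ)) a⁻¹ a + K < wordLength X a := by
  by_contra! hbad
  have hD := h.constant_nonneg
  obtain ⟨K', hK'⟩ : ∃ K' : ℕ, K ≤ K' := ⟨K.toNat, Int.self_le_toNat K⟩
  obtain ⟨t, ht⟩ : ∃ t : ℕ, 4 * D + K < t := ⟨(4 * D + K).toNat + 1, by omega⟩
  obtain ⟨x, hx⟩ := hunb (3 * t + K')
  obtain ⟨γ, hγ⟩ := exists_isGeodesic hX 1 x
  set n := wordDist X 1 x with hn
  have hnx : n = wordLength X x := by simp [hn, wordDist]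
  have hd : ∀ i j, i ≤ n → j ≤ n → wordLength X ((γ i)⁻¹ * γ j) = Nat.dist i j := hγ.2.2
  -- the segment starting at `i` is close to the reversed segment ending at `n`
  have close : ∀ i, i + 2 * t + K' ≤ n →
      2 * t - 2 * D ≤ gromovProduct (fun g => (wordLength X g : ℤ))
        ((γ i)⁻¹ * γ (i + t)) ((γ n)⁻¹ * γ (n - t)) := by
    intro i hi
    have hb := hbad ((γ i)⁻¹ * γ n)
    have e₁ : gromovProduct (fun g => (wordLength X g : ℤ))
        ((γ i)⁻¹ * γ (i + t)) ((γ i)⁻¹ * γ n) = 2 * t := by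
      simp only [gromovProduct, mul_inv_rev, inv_inv, mul_assoc, mul_inv_cancel_left]
      rw [hd _ _ (by omega) (by omega), hd _ _ (by omega) (by omega), hd _ _ (by omega) (by omega)]
      simp only [Nat.dist]
      omega
    have e₂ : gromovProduct (fun g => (wordLength X g : ℤ))
        ((γ i)⁻¹ * γ n)⁻¹ ((γ n)⁻¹ * γ (n - t)) = 2 * t := by
      simp only [gromovProduct, mul_inv_rev, inv_inv, mul_assoc, mul_inv_cancel_left]
      rw [hd _ _ (by omega) (by omega), hd _ _ (by omega) (by omega), hd _ _ (by omega) (by omega)]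
      simp only [Nat.dist]
      omega
    rw [hd _ _ (by omega) le_rfl, h.gromovProduct_comm] at hb
    simp only [Nat.dist] at hb
    have m₁ := h.min_gromovProduct_le ((γ i)⁻¹ * γ (i + t)) ((γ i)⁻¹ * γ n) ((γ i)⁻¹ * γ n)⁻¹
    have m₂ := h.min_gromovProduct_le ((γ i)⁻¹ * γ (i + t)) ((γ i)⁻¹ * γ n)⁻¹
      ((γ n)⁻¹ * γ (n - t))
    rcases min_le_iff.1 m₁ with h' | h' <;> rcases min_le_iff.1 m₂ with h'' | h'' <;> omega
  have hγ0 : γ 0 = 1 := hγ.1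
  have c₁ := close 0 (by omega)
  have c₂ := close t (by omega)
  have e₀ := hd 0 t (by omega) (by omega)
  have e₁ := hd t (t + t) (by omega) (by omega)
  have e₂ := hd n (n - t) le_rfl (by omega)
  have e₃ := hd 0 (t + t) (by omega) (by omega)
  simp only [hγ0, zero_add, inv_one, one_mul, Nat.dist] at c₁ e₀ e₁ e₂ e₃
  simp only [gromovProduct] at c₁ c₂
  have hb := hbad (γ t)
  have sq := h.map_mul_eq (γ t) (γ t)
  have tri₁ := wordDist_triangle hX (γ t) ((γ n)⁻¹ * γ (n - t)) ((γ t)⁻¹ * γ (t + t))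
  have tri₂ := wordLength_mul_le hX (γ t * γ t) ((γ t)⁻¹ * ((γ t)⁻¹ * γ (t + t)))
  have comm := wordDist_comm hX ((γ n)⁻¹ * γ (n - t)) ((γ t)⁻¹ * γ (t + t))
  rw [mul_assoc, mul_inv_cancel_left, mul_inv_cancel_left] at tri₂
  simp only [wordDist] at tri₁ comm
  omega

theorem virtuallyCyclic_of_forall_exists_wordLength_le {X : Finset G}
    (hX : Subgroup.closure (X : Set G) = ⊤) (a : G) (R : ℕ)
    (hR : ∀ g, ∃ n : ℤ, wordLength (X : Set G) (a ^ n * g) ≤ R) : VirtuallyCyclic G := by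
  refine ⟨Subgroup.zpowers a, inferInstance, ?_⟩
  have : Finite {g : G | wordLength (X : Set G) g ≤ R} := wordLength_ball_finite hX R
  have : Finite (G ⧸ Subgroup.zpowers a) := by
    refine Finite.of_surjective
      (fun g : {g : G | wordLength (X : Set G) g ≤ R} => (QuotientGroup.mk g.1⁻¹ : G ⧸ _)) ?_
    intro q
    obtain ⟨g, rfl⟩ := QuotientGroup.mk_surjective q
    obtain ⟨n, hn⟩ := hR g⁻¹
    refine ⟨⟨_, hn⟩, QuotientGroup.eq.2 ?_⟩
    simp
  exact Subgroup.finiteIndex_of_finite_quotient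

/-- A free subsemigroup of rank two forces exponential growth. -/
theorem exists_pow_le_ballCard {X : Finset G} (hX : Subgroup.closure (X : Set G) = ⊤)
    {u : Bool → G} (hu : Function.Injective fun l : List Bool => (l.map u).prod) :
    ∃ lam : ℝ, 1 < lam ∧ ∃ N : ℕ, ∀ n : ℕ, N ≤ n →
      lam ^ n ≤ (ballCard (X : Set G) n : ℝ) := by
  obtain ⟨M, hM0, hM⟩ : ∃ M : ℕ, 0 < M ∧ ∀ b, wordLength (X : Set G) (u b) ≤ M :=
    ⟨max (wordLength X (u true)) (wordLength X (u false)) + 1, by omega,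
      by rintro (_ | _) <;> omega⟩
  have hlen : ∀ l : List Bool, wordLength (X : Set G) (l.map u).prod ≤ M * l.length := by
    intro l
    induction l with
    | nil => simp [wordLength_one]
    | cons b l ih =>
      have := wordLength_mul_le hX (u b) (l.map u).prod
      have := hM b
      simp only [List.map_cons, List.prod_cons, List.length_cons, mul_add, mul_one]
      omega
  have hcard : ∀ n, 2 ^ (n / M) ≤ ballCard (X : Set G) n := by
    intro n
    let f : (Fin (n / M) → Bool) → G := fun v => ((List.ofFn v).map u).prod
    have hf : Function.Injective f := hu.comp List.ofFn_injective
    have hsub : Set.range f ⊆ {g : G | wordLength (X : Set G) g ≤ n} := by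
      rintro _ ⟨v, rfl⟩
      refine (hlen _).trans ?_
      rw [List.length_ofFn]
      exact Nat.mul_div_le n M
    have := Set.ncard_le_ncard hsub (wordLength_ball_finite hX n)
    rwa [Set.ncard_range_of_injective hf, Nat.card_eq_fintype_card, Fintype.card_fun,
      Fintype.card_bool, Fintype.card_fin] at this
  refine ⟨(2 : ℝ) ^ ((2 * M : ℝ)⁻¹), Real.one_lt_rpow one_lt_two (by positivity), M,
    fun n hn => ?_⟩
  have hfloor : n ≤ 2 * M * (n / M) := by
    have h₁ := Nat.div_add_mod n M
    have h₂ := Nat.mod_lt n hM0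
    have h₃ : M * 1 ≤ M * (n / M) := Nat.mul_le_mul_left M (Nat.div_pos hn hM0)
    rw [mul_assoc]
    omega
  calc ((2 : ℝ) ^ ((2 * M : ℝ)⁻¹)) ^ n = (2 : ℝ) ^ ((2 * M : ℝ)⁻¹ * n) := by
        rw [Real.rpow_mul zero_le_two, Real.rpow_natCast]
    _ ≤ (2 : ℝ) ^ ((n / M : ℕ) : ℝ) := by
        refine Real.rpow_le_rpow_of_exponent_le one_le_two ?_
        rw [inv_mul_le_iff₀ (by positivity)]
        exact_mod_cast hfloor
    _ = (2 : ℝ) ^ (n / M) := Real.rpow_natCast _ _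
    _ ≤ ballCard (X : Set G) n := by exact_mod_cast hcard n

end Growth

/-- A non-elementary word-hyperbolic group with a finite generating set `X` has exponential
growth: there is `λ > 1` with `𝔅(n) ≥ λ^n` for all sufficiently large `n`. -/
theorem nonelementary_hyperbolic_exponential_growth {G : Type*} [Group G] (X : Finset G)
    (hgen : Subgroup.closure (X : Set G) = ⊤)
    (hhyp : ∃ δ : ℕ, 1 ≤ δ ∧ TrianglesThin (X : Set G) δ)
    (hinf : Infinite G) (hne : ¬ VirtuallyCyclic G) :
    ∃ lam : ℝ, 1 < lam ∧ ∃ N : ℕ, ∀ n : ℕ, N ≤ n →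
      lam ^ n ≤ (ballCard (X : Set G) n : ℝ) := by
  obtain ⟨δ, -, hδ⟩ := hhyp
  have h := hδ.isHyperbolicLength hgen
  have hunb : ∀ n : ℕ, ∃ g : G, n ≤ wordLength (X : Set G) g := by
    by_contra! hn
    obtain ⟨n, hn⟩ := hn
    exact Set.infinite_univ ((wordLength_ball_finite hgen n).subset fun g _ => (hn g).le)
  obtain ⟨a, ha⟩ := h.exists_loxodromic hgen hunb (2 * (6 * δ + 2))
  obtain ⟨u, hu⟩ := h.exists_free_subsemigroup ha fun R => by
    by_contra! hR
    refine hne (virtuallyCyclic_of_forall_exists_wordLength_le hgen a R.toNat fun g => ?_)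
    obtain ⟨m, hm⟩ : ∃ m : ℤ, ∀ n : ℤ,
        wordLength (X : Set G) (a ^ m * g) ≤ wordLength (X : Set G) (a ^ n * g) :=
      ⟨Function.argmin fun n : ℤ => wordLength (X : Set G) (a ^ n * g), fun n =>
        Function.argmin_le (fun n : ℤ => wordLength (X : Set G) (a ^ n * g)) n⟩
    refine ⟨m, ?_⟩
    by_contra! hlt
    obtain ⟨n, hn⟩ := hR (a ^ m * g) (by omega)
    have := hm (n + m)
    rw [zpow_add, mul_assoc] at this
    omega
  exact exists_pow_le_ballCard hgen hu
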